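/- For all integers m,n ≥ 2, the Baumslag–Solitar group BS(m,n) admits an SFT that is weakly aperiodic but not strongly aperiodic: there exist a finite alphabet A and a finite set F of forbidden patterns over BS(m,n) such that X_F is nonempty, every configuration in X_F has infinite orbit, and some configuration in X_F has a nontrivial stabilizer. -/

import Mathlib

/-- The Baumslag–Solitar relation `b a^m b⁻¹ (a^n)⁻¹` in the free group on two generators. -/
def BSrel (m n : ℤ) : Set (FreeGroup (Fin 2)) :=
  {FreeGroup.of 1 * FreeGroup.of 0 ^ m * (FreeGroup.of 1)⁻¹ * (FreeGroup.of 0 ^ n)⁻¹}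

/-- The Baumslag–Solitar group `BS(m,n) = ⟨a, b ∣ b a^m b⁻¹ = a^n⟩`. -/
abbrev BS (m n : ℤ) : Type := PresentedGroup (BSrel m n)

/-- A pattern: a finite subset of the group together with a labelling by the alphabet. -/
structure Pattern (G A : Type) where
  supp : Finset G
  data : supp → A

/-- The pattern `p` appears in the configuration `x : A^G`. -/
def Appears {G A : Type} [Group G] (p : Pattern G A) (x : G → A) : Prop :=
  ∃ g : G, ∀ h : p.supp, x (g⁻¹ * (h : G)) = p.data h

/-- The subshift of finite type defined by the (finite) set of forbidden patterns `F`. -/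
def SFT {G A : Type} [Group G] (F : Set (Pattern G A)) : Set (G → A) :=
  {x | ∀ p ∈ F, ¬ Appears p x}

/-- A local rule on a finite window defines a subshift of finite type. -/
lemma exists_finite_SFT_eq {G A : Type} [Group G] [Finite A] (S : Finset G) (P : Set (S → A)) :
    ∃ F : Set (Pattern G A), F.Finite ∧ SFT F = {x | ∀ g : G, (fun h : S => x (g * h)) ∈ P} := by
  refine ⟨(fun d => ⟨S, d⟩) '' Pᶜ, (Set.toFinite _).image _, ?_⟩
  ext x
  constructor
  · intro hx g
    by_contra hg
    exact hx _ ⟨_, hg, rfl⟩ ⟨g⁻¹, fun h => by simp⟩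
  · rintro hx _ ⟨d, hd, rfl⟩ ⟨g, hg⟩
    apply hd
    convert hx g⁻¹ using 1
    exact (funext hg).symm

/-- The configuration `x` encodes the bounded displacement map `g ↦ g * w (x g)`; the rule says
that every element `h` has two preimages, carrying the labels `(σ, false)` and `(σ, true)`. -/
def TwoToOne {G : Type} [Group G] (w : Bool × Bool → G) (x : G → Bool × Bool) : Prop :=
  ∀ h : G, ∃ σ : Bool, ∀ j : Bool, x (h * (w (σ, j))⁻¹) = (σ, j)

lemma exists_SFT_eq_twoToOne {G : Type} [Group G] (w : Bool × Bool → G) :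
    ∃ F : Set (Pattern G (Bool × Bool)), F.Finite ∧ SFT F = {x | TwoToOne w x} := by
  classical
  obtain ⟨F, hF, h⟩ := exists_finite_SFT_eq (Finset.univ.image fun t => (w t)⁻¹)
    {d | ∃ σ : Bool, ∀ j : Bool,
      d ⟨(w (σ, j))⁻¹, Finset.mem_image_of_mem _ (Finset.mem_univ _)⟩ = (σ, j)}
  exact ⟨F, hF, h⟩

/-- A finite set has no two-to-one self-map onto itself, so the orbit is infinite. -/
lemma TwoToOne.infinite_orbit {G : Type} [Group G] {w : Bool × Bool → G} {x : G → Bool × Bool}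
    (hx : TwoToOne w x) : {y : G → Bool × Bool | ∃ g : G, y = fun h => x (g⁻¹ * h)}.Infinite := by
  intro hfin
  set O := {y : G → Bool × Bool | ∃ g : G, y = fun h => x (g⁻¹ * h)} with hO
  let ψ : (G → Bool × Bool) → G → Bool × Bool := fun y h => y (w (y 1) * h)
  have hmaps : Set.MapsTo ψ O O := by
    rintro _ ⟨g, rfl⟩
    exact ⟨(g⁻¹ * w (x (g⁻¹ * 1)))⁻¹, by funext h; simp [ψ, mul_assoc]⟩
  have hpre : ∀ y ∈ O, ∃ σ : Bool, ∀ j : Bool, ∃ z ∈ O, ψ z = y ∧ z 1 = (σ, j) := by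
    rintro _ ⟨g, rfl⟩
    obtain ⟨σ, hσ⟩ := hx g⁻¹
    refine ⟨σ, fun j => ⟨fun h => x (g⁻¹ * (w (σ, j))⁻¹ * h), ⟨w (σ, j) * g, by simp⟩, ?_, ?_⟩⟩
    · funext h
      simp [ψ, hσ]
    · simp [hσ]
  have hsurj : Set.SurjOn ψ O O := fun y hy => by
    obtain ⟨σ, h⟩ := hpre y hy
    obtain ⟨z, hz, hzy, -⟩ := h false
    exact ⟨z, hz, hzy⟩
  have hinj : Set.InjOn ψ O := ((hfin.surjOn_iff_bijOn_of_mapsTo hmaps).1 hsurj).injOn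
  obtain ⟨σ, h⟩ := hpre x ⟨1, by simp⟩
  obtain ⟨z, hz, hzx, hz1⟩ := h false
  obtain ⟨z', hz', hzx', hz1'⟩ := h true
  have := hinj hz hz' (hzx.trans hzx'.symm)
  simp [← this, hz1] at hz1'

/-- The configuration read off from an action of `G`, a labelling and a base point. -/
def orbitConfig {G X A : Type} [Group G] (ρ : G →* Equiv.Perm X) (f : X → A) (x₀ : X) : G → A :=
  fun g => f (ρ g⁻¹ x₀)

lemma twoToOne_orbitConfig {G X : Type} [Group G] (ρ : G →* Equiv.Perm X) (f : X → Bool × Bool)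
    (x₀ : X) (w : Bool × Bool → G)
    (h : ∀ y : X, ∃ σ : Bool, ∀ j : Bool, f (ρ (w (σ, j)) y) = (σ, j)) :
    TwoToOne w (orbitConfig ρ f x₀) := by
  intro g
  obtain ⟨σ, hσ⟩ := h (ρ g⁻¹ x₀)
  exact ⟨σ, fun j => by simpa [orbitConfig] using hσ j⟩

lemma orbitConfig_translate {G X A : Type} [Group G] (ρ : G →* Equiv.Perm X) (f : X → A)
    (x₀ : X) (g : G) (hg : ρ g x₀ = x₀) :
    (fun h => orbitConfig ρ f x₀ (g⁻¹ * h)) = orbitConfig ρ f x₀ := by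
  funext h
  simp [orbitConfig, hg]

/-- A gluing of half-edges. On the left copy of `ℕ`, the half-edges of index `0` cover all
half-edges of the left copy; dually, all half-edges of the right copy are sent to the half-edges
of index `0` of the right copy. -/
def halfEdgeEquiv (M N : ℕ) :
    (ℕ ⊕ ℕ) × Fin (M + 2) ≃ (ℕ ⊕ ℕ) × Fin (N + 2) :=
  let d : ℕ × Fin (M + 1) ≃ ℕ × Fin (N + 1) :=
    (Nat.divModEquiv (M + 1)).symm.trans (Nat.divModEquiv (N + 1))
  { toFun := fun p => match p with
      | (Sum.inl k, r) => Fin.cases (Sum.inl (Nat.divModEquiv (N + 2) k).1,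
          (Nat.divModEquiv (N + 2) k).2) (fun s => (Sum.inr (d (k, s)).1, (d (k, s)).2.succ)) r
      | (Sum.inr k, r) => (Sum.inr ((Nat.divModEquiv (M + 2)).symm (k, r)), 0)
    invFun := fun p => match p with
      | (Sum.inl k, r) => (Sum.inl ((Nat.divModEquiv (N + 2)).symm (k, r)), 0)
      | (Sum.inr k, r) => Fin.cases (Sum.inr (Nat.divModEquiv (M + 2) k).1,
          (Nat.divModEquiv (M + 2) k).2)
          (fun s => (Sum.inl (d.symm (k, s)).1, (d.symm (k, s)).2.succ)) r
    left_inv := by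
      rintro ⟨k | k, r⟩
      · refine Fin.cases ?_ (fun s => ?_) r
        · simp only [Fin.cases_zero, Prod.mk.eta, Equiv.symm_apply_apply]
        · simp only [Fin.cases_succ, Prod.mk.eta, Equiv.symm_apply_apply]
      · simp only [Fin.cases_zero, Equiv.apply_symm_apply]
    right_inv := by
      rintro ⟨k | k, r⟩
      · simp only [Fin.cases_zero, Equiv.apply_symm_apply]
      · refine Fin.cases ?_ (fun s => ?_) r
        · simp only [Fin.cases_zero, Prod.mk.eta, Equiv.symm_apply_apply]
        · simp only [Fin.cases_succ, Prod.mk.eta, Equiv.apply_symm_apply] }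

lemma halfEdgeEquiv_symm_inl (M N k : ℕ) (r : Fin (N + 2)) :
    (halfEdgeEquiv M N).symm (Sum.inl k, r) =
      (Sum.inl ((Nat.divModEquiv (N + 2)).symm (k, r)), 0) := rfl

lemma halfEdgeEquiv_inr (M N k : ℕ) (r : Fin (M + 2)) :
    halfEdgeEquiv M N (Sum.inr k, r) =
      (Sum.inr ((Nat.divModEquiv (M + 2)).symm (k, r)), 0) := rfl

lemma halfEdgeEquiv_inl_zero (M N : ℕ) :
    halfEdgeEquiv M N (Sum.inl 0, 0) = (Sum.inl 0, 0) := by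
  rw [← Equiv.eq_symm_apply, halfEdgeEquiv_symm_inl]
  simp

/-- Cutting each line `{v} × ℤ` into its residue classes modulo `n`. -/
def residueEquiv (V : Type) (n : ℕ) [NeZero n] : V × ℤ ≃ (V × Fin n) × ℤ :=
  ((Equiv.refl V).prodCongr ((Int.divModEquiv n).trans (Equiv.prodComm _ _))).trans
    (Equiv.prodAssoc _ _ _).symm

lemma residueEquiv_symm_apply {V : Type} {n : ℕ} [NeZero n] (e : V × Fin n) (q : ℤ) :
    (residueEquiv V n).symm (e, q) = (e.1, q * n + (e.2 : ℕ)) := rfl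

/-- The unit translation along every line. -/
def lineShift (V : Type) : Equiv.Perm (V × ℤ) := (Equiv.refl V).prodCongr (Equiv.addRight 1)

lemma lineShift_zpow_apply {V : Type} (i : ℤ) (v : V) (k : ℤ) :
    (lineShift V ^ i) (v, k) = (v, k + i) := by
  induction i using Int.induction_on generalizing k with
  | zero => simp
  | succ i ih =>
    have : lineShift V (v, k) = (v, k + 1) := rfl
    rw [zpow_add_one, Equiv.Perm.mul_apply, this, ih]
    congr 1; ring
  | pred i ih =>
    have : (lineShift V)⁻¹ (v, k) = (v, k - 1) := by
      rw [Equiv.Perm.inv_eq_iff_eq]; simp [lineShift]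
    rw [zpow_sub_one, Equiv.Perm.mul_apply, this, ih]
    congr 1; ring

/-- The permutation of lines induced by a matching `e` of residue classes. -/
def residueGlue {V : Type} {m n : ℕ} [NeZero m] [NeZero n] (e : V × Fin m ≃ V × Fin n) :
    Equiv.Perm (V × ℤ) :=
  (residueEquiv V m).trans ((e.prodCongr (Equiv.refl ℤ)).trans (residueEquiv V n).symm)

lemma residueGlue_apply {V : Type} {m n : ℕ} [NeZero m] [NeZero n] (e : V × Fin m ≃ V × Fin n)
    (p : V × Fin m) (q : ℤ) :
    residueGlue e (p.1, q * m + (p.2 : ℕ)) = ((e p).1, q * n + ((e p).2 : ℕ)) := by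
  rw [← residueEquiv_symm_apply, ← residueEquiv_symm_apply]
  simp [residueGlue]

lemma exists_residue {V : Type} (n : ℕ) [NeZero n] (y : V × ℤ) :
    ∃ (p : V × Fin n) (q : ℤ), y = (p.1, q * n + (p.2 : ℕ)) :=
  ⟨(residueEquiv V n y).1, (residueEquiv V n y).2, by rw [← residueEquiv_symm_apply]; simp⟩

lemma residueGlue_relation {V : Type} {m n : ℕ} [NeZero m] [NeZero n]
    (e : V × Fin m ≃ V × Fin n) :
    residueGlue e * lineShift V ^ (m : ℤ) * (residueGlue e)⁻¹ * (lineShift V ^ (n : ℤ))⁻¹ = 1 := by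
  rw [mul_inv_eq_one, mul_inv_eq_iff_eq_mul]
  ext1 y
  obtain ⟨p, q, rfl⟩ := exists_residue m y
  rw [Equiv.Perm.mul_apply, Equiv.Perm.mul_apply, residueGlue_apply, lineShift_zpow_apply,
    lineShift_zpow_apply]
  have : q * m + ((p.2 : ℕ) : ℤ) + m = (q + 1) * m + (p.2 : ℕ) := by ring
  rw [this, residueGlue_apply]
  congr 1; ring

/-- A homomorphism out of `BS(m,n)` from a pair satisfying the defining relation. -/
def BS.lift {m n : ℤ} {H : Type} [Group H] (α β : H) (h : β * α ^ m * β⁻¹ * (α ^ n)⁻¹ = 1) :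
    BS m n →* H :=
  PresentedGroup.toGroup (rels := BSrel m n) (f := ![α, β]) (by
    rintro _ rfl
    simpa using h)

lemma BS.lift_of_zero {m n : ℤ} {H : Type} [Group H] (α β : H)
    (h : β * α ^ m * β⁻¹ * (α ^ n)⁻¹ = 1) :
    BS.lift α β h (PresentedGroup.of 0) = α := PresentedGroup.toGroup.of _

lemma BS.lift_of_one {m n : ℤ} {H : Type} [Group H] (α β : H)
    (h : β * α ^ m * β⁻¹ * (α ^ n)⁻¹ = 1) :
    BS.lift α β h (PresentedGroup.of 1) = β := PresentedGroup.toGroup.of _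

lemma BS.of_one_ne_one (m n : ℤ) : (PresentedGroup.of 1 : BS m n) ≠ 1 := by
  intro h
  have := BS.lift_of_one (m := m) (n := n) (1 : Multiplicative ℤ) (Multiplicative.ofAdd 1)
    (by simp)
  rw [h, map_one] at this
  exact absurd this (by decide)

/-- The words moving a point to its two distinguished preimages: `a^j b⁻¹` and `a^j b`. -/
def preimageWord (m n : ℤ) (t : Bool × Bool) : BS m n :=
  PresentedGroup.of 0 ^ (if t.2 then 1 else 0 : ℤ) *
    (if t.1 then (PresentedGroup.of 1)⁻¹ else PresentedGroup.of 1)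

/-- The label of a point: its copy of `ℕ`, and whether it lies off the residue class `0`. -/
def lineLabel (m n : ℤ) (y : (ℕ ⊕ ℕ) × ℤ) : Bool × Bool :=
  match y with
  | (Sum.inl _, k) => (true, !decide (m ∣ k))
  | (Sum.inr _, k) => (false, !decide (n ∣ k))

lemma not_dvd_mul_add_one {m : ℤ} (hm : 2 ≤ m) (q : ℤ) : ¬ m ∣ q * m + 1 := by
  rw [Int.dvd_add_right (Dvd.intro_left q rfl)]
  exact fun h => by have := Int.le_of_dvd one_pos h; omega

/-- For all `m, n ≥ 2`, the group `BS(m,n)` admits an SFT that is weakly aperiodic but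
not strongly aperiodic. -/
theorem BSmn_admits_weakly_not_strongly_aperiodic_SFT (m n : ℤ) (hm : 2 ≤ m) (hn : 2 ≤ n) :
    ∃ (A : Type) (_ : Fintype A) (F : Set (Pattern (BS m n) A)),
      F.Finite ∧ (SFT F).Nonempty ∧
      (∀ x ∈ SFT F, {y : BS m n → A | ∃ g : BS m n, y = fun h => x (g⁻¹ * h)}.Infinite) ∧
      (∃ x ∈ SFT F, ∃ g : BS m n, g ≠ 1 ∧ (fun h => x (g⁻¹ * h)) = x) := by
  obtain ⟨M, rfl⟩ : ∃ M : ℕ, m = ((M + 2 : ℕ) : ℤ) := ⟨(m - 2).toNat, by omega⟩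
  obtain ⟨N, rfl⟩ : ∃ N : ℕ, n = ((N + 2 : ℕ) : ℤ) := ⟨(n - 2).toNat, by omega⟩
  obtain ⟨F, hF, hSFT⟩ := exists_SFT_eq_twoToOne (preimageWord (M + 2 : ℕ) (N + 2 : ℕ))
  let β := residueGlue (halfEdgeEquiv M N)
  let ρ := BS.lift (lineShift (ℕ ⊕ ℕ)) β (residueGlue_relation _)
  have hρ : ∀ σ j y, ρ (preimageWord _ _ (σ, j)) y =
      (lineShift (ℕ ⊕ ℕ) ^ (if j then 1 else 0 : ℤ)) ((if σ then β⁻¹ else β) y) := by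
    intro σ j y
    cases σ <;> cases j <;> simp [preimageWord, ρ, BS.lift_of_zero, BS.lift_of_one]
  let x := orbitConfig ρ (lineLabel (M + 2 : ℕ) (N + 2 : ℕ)) (Sum.inl 0, 0)
  have hx : x ∈ SFT F := by
    rw [hSFT]
    refine twoToOne_orbitConfig _ _ _ _ ?_
    rintro ⟨k | k, i⟩
    · obtain ⟨⟨v, r⟩, q, hq⟩ := exists_residue (N + 2) ((Sum.inl k : ℕ ⊕ ℕ), i)
      obtain ⟨rfl, rfl⟩ := Prod.mk.inj hq
      refine ⟨true, fun j => ?_⟩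
      have hβ : β⁻¹ (Sum.inl k, q * (N + 2 : ℕ) + (r : ℕ)) =
          (Sum.inl ((Nat.divModEquiv (N + 2)).symm (k, r)), q * (M + 2 : ℕ)) := by
        rw [Equiv.Perm.inv_eq_iff_eq]
        have := residueGlue_apply (halfEdgeEquiv M N)
          ((halfEdgeEquiv M N).symm (Sum.inl k, r)) q
        rw [Equiv.apply_symm_apply, halfEdgeEquiv_symm_inl] at this
        simpa using this.symm
      rw [hρ, if_pos rfl, hβ, lineShift_zpow_apply]
      cases j
      · simp [lineLabel]
      · simpa [lineLabel] using not_dvd_mul_add_one hm q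
    · obtain ⟨⟨v, r⟩, q, hq⟩ := exists_residue (M + 2) ((Sum.inr k : ℕ ⊕ ℕ), i)
      obtain ⟨rfl, rfl⟩ := Prod.mk.inj hq
      refine ⟨false, fun j => ?_⟩
      have hβ : β (Sum.inr k, q * (M + 2 : ℕ) + (r : ℕ)) =
          (Sum.inr ((Nat.divModEquiv (M + 2)).symm (k, r)), q * (N + 2 : ℕ)) := by
        have := residueGlue_apply (halfEdgeEquiv M N) (Sum.inr k, r) q
        rw [halfEdgeEquiv_inr] at this
        simpa using this
      rw [hρ, if_neg Bool.false_ne_true, hβ, lineShift_zpow_apply]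
      cases j
      · simp [lineLabel]
      · simpa [lineLabel] using not_dvd_mul_add_one hn q
  refine ⟨Bool × Bool, inferInstance, F, hF, ⟨x, hx⟩, fun y hy => ?_, x, hx,
    PresentedGroup.of 1, BS.of_one_ne_one _ _, orbitConfig_translate _ _ _ _ ?_⟩
  · rw [hSFT] at hy
    exact TwoToOne.infinite_orbit hy
  · rw [BS.lift_of_one]
    simpa [halfEdgeEquiv_inl_zero] using residueGlue_apply (halfEdgeEquiv M N) (Sum.inl 0, 0) 0
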